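/- arXiv:math/0510578 — 3 statements merged into one kernel-verified Lean document; each statement's English description precedes it below -/
import Mathlib

section
/- Let ρ : ℝ → [-∞, ∞) satisfy: (i) ρ(α) = -∞ for every rational α, and (ii) ρ has the intermediate value property (for all α < β and real r strictly between ρ(α) and ρ(β), there exists γ ∈ [α, β] with ρ(γ) = r). Then for any α ∈ ℝ and any real r̃ < ρ(α), there exists a sequence αₙ → α with ρ(αₙ) = r̃ for all n. -/
open Filter Set

theorem stmt1 (ρ : ℝ → EReal)
    (htop : ∀ α : ℝ, ρ α < ⊤)
    (hrat : ∀ q : ℚ, ρ (q : ℝ) = ⊥)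
    (hivp : ∀ α β : ℝ, α < β → ∀ r : ℝ,
      ((ρ α < (r : EReal) ∧ (r : EReal) < ρ β) ∨ (ρ β < (r : EReal) ∧ (r : EReal) < ρ α)) →
      ∃ γ ∈ Set.Icc α β, ρ γ = (r : EReal)) :
    ∀ α : ℝ, ∀ rt : ℝ, (rt : EReal) < ρ α →
      ∃ a : ℕ → ℝ, Filter.Tendsto a Filter.atTop (nhds α) ∧ ∀ n, ρ (a n) = (rt : EReal) := by
  intro α rt h
  have key : ∀ n : ℕ, ∃ γ : ℝ, γ ∈ Set.Icc α (α + 1 / ((n : ℝ) + 1)) ∧ ρ γ = (rt : EReal) := by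
    intro n
    have hpos : (0 : ℝ) < 1 / ((n : ℝ) + 1) := by positivity
    obtain ⟨q, hq1, hq2⟩ := exists_rat_btwn (lt_add_of_pos_right α hpos)
    obtain ⟨γ, hγ, hr⟩ := hivp α q hq1 rt (Or.inr ⟨by rw [hrat]; exact EReal.bot_lt_coe rt, h⟩)
    exact ⟨γ, ⟨hγ.1, hγ.2.trans hq2.le⟩, hr⟩
  choose a ha hr using key
  refine ⟨a, ?_, hr⟩
  have ht : Filter.Tendsto (fun n : ℕ => α + 1 / ((n : ℝ) + 1)) Filter.atTop (nhds α) := by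
    simpa using (tendsto_one_div_add_atTop_nhds_zero_nat (𝕜 := ℝ)).const_add α
  exact tendsto_of_tendsto_of_tendsto_of_le_of_le tendsto_const_nhds ht
    (fun n => (ha n).1) (fun n => (ha n).2)
end

section
/- Let u be a harmonic function on the open unit disc 𝔻, bounded above by M ∈ ℝ. Suppose α ∈ ℝ, δ > 0, and L, R ∈ ℝ are such that the radial limit ρ(β) := lim_{r→1} u(r e^{2πiβ}) exists for all β and satisfies ρ(β) ≤ L for α - δ ≤ β < α and ρ(β) ≤ R for α < β ≤ α + δ. Then ρ(α) ≤ (L + R)/2. -/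
open Filter Set Metric Complex Real

/-- A real-valued function is harmonic on the open unit disc iff it is the real
part of a holomorphic function there (the disc is simply connected). -/
def HarmonicOnUnitDisc (u : ℂ → ℝ) : Prop :=
  ∃ f : ℂ → ℂ, DifferentiableOn ℂ f (Metric.ball (0 : ℂ) 1) ∧
    ∀ z ∈ Metric.ball (0 : ℂ) 1, u z = (f z).re

theorem aux_poisson (G : ℂ → ℂ) (hG : DifferentiableOn ℂ G (Metric.ball (0 : ℂ) 1)) (B : ℝ)
    (hB : ∀ z ∈ Metric.ball (0 : ℂ) 1, (G z).re ≤ B)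
    (hlim : ∀ t : ℝ, 0 < t → t < 2 * π → ∀ ε : ℝ, 0 < ε →
      ∀ᶠ s : ℝ in nhdsWithin 1 (Set.Iio 1), (G (s * circleMap 0 1 t)).re < ε)
    (w : ℂ) (hw : w ∈ Metric.ball (0 : ℂ) 1) : (G w).re ≤ 0 := by
  have hs : Tendsto (fun n : ℕ => 1 - 1 / ((n : ℝ) + 1)) atTop (nhdsWithin 1 (Set.Iio 1)) := by
    refine tendsto_nhdsWithin_iff.2 ⟨?_, ?_⟩
    · simpa using (tendsto_one_div_add_atTop_nhds_zero_nat (𝕜 := ℝ)).const_sub 1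
    · filter_upwards with n
      have : 0 < 1 / ((n : ℝ) + 1) := by positivity
      simp only [Set.mem_Iio]; linarith
  set s : ℕ → ℝ := fun n => 1 - 1 / ((n : ℝ) + 1) with hsdef
  have hs1 : ∀ n, s n < 1 := by
    intro n
    have : 0 < 1 / ((n : ℝ) + 1) := by positivity
    simp only [hsdef]; linarith
  have hs0 : ∀ n, 0 ≤ s n := by
    intro n
    have : 1 / ((n : ℝ) + 1) ≤ 1 := by
      rw [div_le_one (by positivity)]; linarith [(n.cast_nonneg : (0 : ℝ) ≤ n)]
    simp only [hsdef]; linarith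
  have hball : ∀ n, ∀ z : ℂ, ‖z‖ ≤ 1 → (s n : ℂ) * z ∈ Metric.ball (0 : ℂ) 1 := by
    intro n z hz
    rw [mem_ball_zero_iff, norm_mul, Complex.norm_real, Real.norm_of_nonneg (hs0 n)]
    nlinarith [hs1 n, hs0 n, norm_nonneg z]
  have hw1 : ‖w‖ < 1 := by simpa using hw
  have hcirc : ∀ t : ℝ, ‖circleMap 0 1 t‖ = 1 := by intro t; simp
  -- the kernel along the circle
  set P : ℝ → ℝ := fun t => poissonKernel 0 w (circleMap 0 1 t) with hP
  have hne : ∀ t : ℝ, ‖circleMap 0 1 t - w‖ ≠ 0 := by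
    intro t h
    rw [norm_eq_zero, sub_eq_zero] at h
    have := hcirc t
    rw [h] at this
    linarith
  have hPeq : ∀ t, P t = (1 - ‖w‖ ^ 2) / ‖circleMap 0 1 t - w‖ ^ 2 := by
    intro t
    simp [hP, poissonKernel_def]
  have hPcont : Continuous P := by
    have : P = fun t => (1 - ‖w‖ ^ 2) / ‖circleMap 0 1 t - w‖ ^ 2 := funext hPeq
    rw [this]
    refine Continuous.div continuous_const (by fun_prop) (fun t => pow_ne_zero 2 (hne t))
  have hPpos : ∀ t, 0 ≤ P t := by
    intro t
    rw [hPeq]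
    have : ‖w‖ ^ 2 ≤ 1 := by nlinarith [norm_nonneg w]
    exact div_nonneg (by linarith) (by positivity)
  have hGc : ∀ n, Continuous (fun t : ℝ => (G (s n * circleMap 0 1 t)).re) := by
    intro n
    refine Complex.continuous_re.comp (hG.continuousOn.comp_continuous (by fun_prop) ?_)
    intro t
    exact hball n _ (hcirc t).le
  have key : ∀ n, (G (s n * w)).re ≤
      (2 * π)⁻¹ * ∫ t in (0 : ℝ)..2 * π, P t * max (G (s n * circleMap 0 1 t)).re 0 := by
    intro n
    have hharm : InnerProductSpace.HarmonicOnNhd (fun z : ℂ => (G (s n * z)).re)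
        (Metric.closedBall 0 1) := by
      intro z hz
      have hz' := hball n z (by simpa using hz)
      have h1 : AnalyticAt ℂ G (s n * z) := hG.analyticAt (isOpen_ball.mem_nhds hz')
      have h2 : AnalyticAt ℂ (fun z : ℂ => G (s n * z)) z :=
        AnalyticAt.fun_comp (f := fun z : ℂ => (s n : ℂ) * z) h1 (by fun_prop)
      exact h2.harmonicAt_re
    have h := hharm.circleAverage_poissonKernel_smul hw
    rw [← h, Real.circleAverage_def, smul_eq_mul]
    refine mul_le_mul_of_nonneg_left ?_ (by positivity)
    refine intervalIntegral.integral_mono_on (by positivity) ?_ ?_ ?_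
    · exact (hPcont.mul (hGc n)).intervalIntegrable _ _
    · exact (hPcont.mul ((hGc n).max continuous_const)).intervalIntegrable _ _
    · intro t _
      exact mul_le_mul_of_nonneg_left (le_max_left _ _) (hPpos t)
  have hintegral : Tendsto (fun n => ∫ t in (0 : ℝ)..2 * π, P t * max (G (s n * circleMap 0 1 t)).re 0)
      atTop (nhds (∫ t in (0 : ℝ)..2 * π, (0 : ℝ))) := by
    refine intervalIntegral.tendsto_integral_filter_of_dominated_convergence
      (fun t => P t * max B 0) ?_ ?_ ?_ ?_
    · filter_upwards with n
      exact (hPcont.mul ((hGc n).max continuous_const)).aestronglyMeasurable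
    · filter_upwards with n
      filter_upwards with t _
      rw [Real.norm_of_nonneg (mul_nonneg (hPpos t) (le_max_right _ _))]
      exact mul_le_mul_of_nonneg_left (max_le_max_right _ (hB _ (hball n _ (hcirc t).le))) (hPpos t)
    · exact (hPcont.mul continuous_const).intervalIntegrable _ _
    · have hae : ∀ᵐ t : ℝ, t ≠ 2 * π := by
        simp [MeasureTheory.ae_iff]
      filter_upwards [hae] with t ht htm
      rw [Set.uIoc_of_le (by positivity)] at htm
      have hl := hlim t htm.1 (lt_of_le_of_ne htm.2 ht)
      have : Tendsto (fun n => max (G (s n * circleMap 0 1 t)).re 0) atTop (nhds 0) := by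
        refine tendsto_order.2 ⟨fun a ha => ?_, fun a ha => ?_⟩
        · filter_upwards with n
          exact lt_of_lt_of_le ha (le_max_right _ _)
        · filter_upwards [hs.eventually (hl a ha)] with n hn
          exact max_lt hn ha
      simpa using this.const_mul (P t)
  have hleft : Tendsto (fun n => (G (s n * w)).re) atTop (nhds (G w).re) := by
    have hc : ContinuousAt G w := (hG.differentiableAt (isOpen_ball.mem_nhds hw)).continuousAt
    have h1 : Tendsto (fun n => (s n : ℂ) * w) atTop (nhds w) := by
      have : Tendsto (fun n => (s n : ℂ)) atTop (nhds ((1 : ℝ) : ℂ)) :=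
        (Complex.continuous_ofReal.tendsto 1).comp (tendsto_nhdsWithin_iff.1 hs).1
      simpa using this.mul_const w
    exact (Complex.continuous_re.tendsto _).comp (hc.tendsto.comp h1)
  have := le_of_tendsto_of_tendsto' hleft (hintegral.const_mul _) key
  simpa using this

theorem stmt3 (u : ℂ → ℝ) (M : ℝ)
    (hu : HarmonicOnUnitDisc u)
    (hM : ∀ z ∈ Metric.ball (0 : ℂ) 1, u z ≤ M)
    (ρ : ℝ → EReal)
    (hρtop : ∀ β : ℝ, ρ β ≤ (M : EReal))
    (hrad : ∀ β : ℝ, Filter.Tendsto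
      (fun r : ℝ => ((u ((r : ℂ) * Complex.exp (2 * Real.pi * Complex.I * (β : ℂ)))) : EReal))
      (nhdsWithin 1 (Set.Iio 1)) (nhds (ρ β)))
    (α δ L R : ℝ) (hδ : 0 < δ)
    (hL : ∀ β : ℝ, α - δ ≤ β → β < α → ρ β ≤ (L : EReal))
    (hR : ∀ β : ℝ, α < β → β ≤ α + δ → ρ β ≤ (R : EReal)) :
    ρ α ≤ (((L + R) / 2 : ℝ) : EReal) := by
  obtain ⟨f, hf, hfu⟩ := hu
  have hev : ∀ β : ℝ, ∀ K : ℝ, ρ β ≤ (K : EReal) → ∀ ε : ℝ, 0 < ε →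
      ∀ᶠ s : ℝ in nhdsWithin 1 (Set.Iio 1),
        u ((s : ℂ) * Complex.exp (2 * Real.pi * Complex.I * (β : ℂ))) < K + ε := by
    intro β K hK ε hε
    have h1 : ρ β < ((K + ε : ℝ) : EReal) :=
      lt_of_le_of_lt hK (EReal.coe_lt_coe_iff.2 (by linarith))
    filter_upwards [(hrad β).eventually_lt_const h1] with s hs
    exact EReal.coe_lt_coe_iff.1 hs
  set K : ℝ := (L + R) / 2 with hK
  set C : ℝ := max M K with hC
  set η : ℝ := min δ (1 / 4) with hη
  have hη0 : 0 < η := lt_min hδ (by norm_num)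
  have hη4 : η ≤ 1 / 4 := min_le_right _ _
  have hηδ : η ≤ δ := min_le_left _ _
  have hcos : Real.cos (2 * π * η) < 1 := by
    rw [← Real.cos_zero]
    exact Real.cos_lt_cos_of_nonneg_of_le_pi le_rfl (by nlinarith [Real.pi_pos]) (by positivity)
  set D : ℝ := (C - K) / (1 - Real.cos (2 * π * η)) with hD
  have hD0 : 0 ≤ D := div_nonneg (sub_nonneg.2 (le_max_right _ _)) (by linarith)
  set e : ℂ := Complex.exp (2 * Real.pi * Complex.I * (α : ℂ)) with he
  have hen : ‖e‖ = 1 := by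
    have : e = Complex.exp ((2 * π * α : ℝ) * Complex.I) := by
      rw [he]; congr 1; push_cast; ring
    rw [this, Complex.norm_exp_ofReal_mul_I]
  set F : ℂ → ℂ := fun z => (f (e * z) + starRingEnd ℂ (f (e * starRingEnd ℂ z))) / 2 with hF
  set G : ℂ → ℂ := fun z => F z - (K + D * (1 - z)) with hGdef
  have hmem : ∀ z ∈ Metric.ball (0 : ℂ) 1, e * z ∈ Metric.ball (0 : ℂ) 1 := by
    intro z hz
    simpa [hen] using hz
  have hconj : ∀ z ∈ Metric.ball (0 : ℂ) 1, starRingEnd ℂ z ∈ Metric.ball (0 : ℂ) 1 := by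
    intro z hz
    simpa using hz
  have hGdiff : DifferentiableOn ℂ G (Metric.ball (0 : ℂ) 1) := by
    intro z hz
    have h1 : ∀ z ∈ Metric.ball (0 : ℂ) 1, DifferentiableAt ℂ (fun z => f (e * z)) z := by
      intro z hz
      exact DifferentiableAt.comp z
        (hf.differentiableAt (isOpen_ball.mem_nhds (hmem z hz))) (by fun_prop)
    have h2 : DifferentiableAt ℂ
        (fun z => starRingEnd ℂ (f (e * starRingEnd ℂ z))) z := by
      have := (h1 _ (hconj z hz)).conj_conj
      simpa [Function.comp_def] using this
    have h3 := h1 z hz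
    apply DifferentiableAt.differentiableWithinAt
    exact ((h3.add h2).div_const 2).sub
      (by fun_prop : DifferentiableAt ℂ (fun z : ℂ => (K : ℂ) + D * (1 - z)) z)
  have hGre : ∀ z ∈ Metric.ball (0 : ℂ) 1, (G z).re =
      (u (e * z) + u (e * starRingEnd ℂ z)) / 2 - (K + D * (1 - z.re)) := by
    intro z hz
    rw [hfu _ (hmem z hz), hfu _ (hmem _ (hconj z hz))]
    simp [hGdef, hF]
  have hpole : ∀ z ∈ Metric.ball (0 : ℂ) 1, z.re ≤ 1 := by
    intro z hz
    have : ‖z‖ < 1 := by simpa using hz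
    exact (Complex.re_le_norm z).trans this.le
  have hGle : ∀ z ∈ Metric.ball (0 : ℂ) 1, (G z).re ≤ 0 := by
    refine aux_poisson G hGdiff (M - K) ?_ ?_
    · intro z hz
      rw [hGre z hz]
      have h1 := hM _ (hmem z hz)
      have h2 := hM _ (hmem _ (hconj z hz))
      have h3 := mul_nonneg hD0 (sub_nonneg.2 (hpole z hz))
      linarith
    · intro t ht0 ht2 ε hε
      have hsI : ∀ᶠ s : ℝ in nhdsWithin 1 (Set.Iio 1), s ∈ Set.Ioo (0 : ℝ) 1 :=
        Ioo_mem_nhdsLT one_pos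
      have hb : ∀ s ∈ Set.Ioo (0 : ℝ) 1, (s : ℂ) * circleMap 0 1 t ∈ Metric.ball (0 : ℂ) 1 := by
        intro s hs
        simp [abs_of_pos hs.1, hs.2]
      have hre : ∀ s : ℝ, ((s : ℂ) * circleMap 0 1 t).re = s * Real.cos t := by
        intro s
        simp [circleMap, Complex.exp_ofReal_mul_I_re]
      -- rewriting points
      have hp : ∀ (s : ℝ) (k : ℤ), e * ((s : ℂ) * circleMap 0 1 t) =
          (s : ℂ) * Complex.exp (2 * Real.pi * Complex.I * ((α + t / (2 * π) - k : ℝ) : ℂ)) := by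
        intro s k
        have : (2 * Real.pi * Complex.I * ((α + t / (2 * π) - k : ℝ) : ℂ) : ℂ) =
            2 * Real.pi * Complex.I * (α : ℂ) + t * Complex.I - k * (2 * Real.pi * Complex.I) := by
          have := Complex.ofReal_ne_zero.2 Real.pi_ne_zero
          push_cast; field_simp
        rw [this, Complex.exp_sub, Complex.exp_int_mul_two_pi_mul_I, Complex.exp_add, div_one]
        simp only [circleMap, he]
        push_cast; ring
      have hq : ∀ (s : ℝ) (k : ℤ), e * starRingEnd ℂ ((s : ℂ) * circleMap 0 1 t) =
          (s : ℂ) * Complex.exp (2 * Real.pi * Complex.I * ((α - (t / (2 * π) - k) : ℝ) : ℂ)) := by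
        intro s k
        have : (2 * Real.pi * Complex.I * ((α - (t / (2 * π) - k) : ℝ) : ℂ) : ℂ) =
            2 * Real.pi * Complex.I * (α : ℂ) + -(t * Complex.I) + k * (2 * Real.pi * Complex.I) := by
          have := Complex.ofReal_ne_zero.2 Real.pi_ne_zero
          push_cast; field_simp; ring
        rw [this, Complex.exp_add, Complex.exp_int_mul_two_pi_mul_I, Complex.exp_add, mul_one]
        have h2 : starRingEnd ℂ (Complex.exp (t * Complex.I)) = Complex.exp (-(t * Complex.I)) := by
          rw [← Complex.exp_conj]; simp
        simp only [circleMap, he, zero_add, map_mul, Complex.conj_ofReal, h2]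
        push_cast; ring
      have hτ0 : 0 < t / (2 * π) := by positivity
      have hτ1 : t / (2 * π) < 1 := by rw [div_lt_one (by positivity)]; exact ht2
      have htτ : t = 2 * π * (t / (2 * π)) := by field_simp
      by_cases hc1 : t / (2 * π) ≤ η
      · filter_upwards [hsI, hev (α + t / (2 * π) - (0 : ℤ)) R
            (hR _ (by push_cast; linarith) (by push_cast; linarith)) ε hε,
          hev (α - (t / (2 * π) - (0 : ℤ))) L
            (hL _ (by push_cast; linarith) (by push_cast; linarith)) ε hε] with s hs h1 h2
        rw [← hp] at h1
        rw [← hq] at h2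
        rw [hGre _ (hb s hs)]
        have h3 := mul_nonneg hD0 (sub_nonneg.2 (hpole _ (hb s hs)))
        linarith
      by_cases hc2 : 1 - η ≤ t / (2 * π)
      · filter_upwards [hsI, hev (α + t / (2 * π) - (1 : ℤ)) L
            (hL _ (by push_cast; linarith) (by push_cast; linarith)) ε hε,
          hev (α - (t / (2 * π) - (1 : ℤ))) R
            (hR _ (by push_cast; linarith) (by push_cast; linarith)) ε hε] with s hs h1 h2
        rw [← hp] at h1
        rw [← hq] at h2
        rw [hGre _ (hb s hs)]
        have h3 := mul_nonneg hD0 (sub_nonneg.2 (hpole _ (hb s hs)))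
        linarith
      push Not at hc1 hc2
      have hct : Real.cos t ≤ Real.cos (2 * π * η) := by
        have hpi := Real.pi_pos
        rcases le_total t π with h | h
        · refine Real.cos_le_cos_of_nonneg_of_le_pi (by positivity) h ?_
          rw [htτ]; gcongr
        · rw [← Real.cos_two_pi_sub t]
          refine Real.cos_le_cos_of_nonneg_of_le_pi (by positivity) (by linarith) ?_
          have : 2 * π - t = 2 * π * (1 - t / (2 * π)) := by field_simp
          rw [this]
          gcongr
          linarith
      have hDc : C - K ≤ D * (1 - Real.cos t) := by
        have : C - K = D * (1 - Real.cos (2 * π * η)) := by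
          rw [hD]
          have : 1 - Real.cos (2 * π * η) ≠ 0 := by linarith
          field_simp
        rw [this]
        gcongr
      have hlimD : Tendsto (fun s : ℝ => D * (1 - s * Real.cos t)) (nhdsWithin 1 (Set.Iio 1))
          (nhds (D * (1 - 1 * Real.cos t))) :=
        ((by fun_prop : Continuous (fun s : ℝ => D * (1 - s * Real.cos t))).tendsto 1).mono_left
          nhdsWithin_le_nhds
      filter_upwards [hsI, hlimD.eventually_const_lt
        (show D * (1 - Real.cos t) - ε < D * (1 - 1 * Real.cos t) by rw [one_mul]; linarith)]
        with s hs h1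
      rw [hGre _ (hb s hs), hre]
      have h2 := hM _ (hmem _ (hb s hs))
      have h3 := hM _ (hmem _ (hconj _ (hb s hs)))
      have h4 : M ≤ C := le_max_left _ _
      linarith
  have hub : ∀ᶠ r : ℝ in nhdsWithin 1 (Set.Iio 1),
      ((u ((r : ℂ) * Complex.exp (2 * Real.pi * Complex.I * (α : ℂ)))) : EReal) ≤
        ((K + D * (1 - r) : ℝ) : EReal) := by
    filter_upwards [Ioo_mem_nhdsLT (one_pos : (0 : ℝ) < 1)] with r hr
    have hb : (r : ℂ) ∈ Metric.ball (0 : ℂ) 1 := by simp [abs_of_pos hr.1, hr.2]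
    have h := hGle _ hb
    rw [hGre _ hb, Complex.conj_ofReal, Complex.ofReal_re] at h
    rw [mul_comm]
    exact EReal.coe_le_coe_iff.2 (by linarith)
  have hlimK : Tendsto (fun r : ℝ => ((K + D * (1 - r) : ℝ) : EReal)) (nhdsWithin 1 (Set.Iio 1))
      (nhds (K : EReal)) := by
    have : Tendsto (fun r : ℝ => K + D * (1 - r)) (nhdsWithin 1 (Set.Iio 1))
        (nhds (K + D * (1 - 1))) :=
      ((by fun_prop : Continuous (fun r : ℝ => K + D * (1 - r))).tendsto 1).mono_left
        nhdsWithin_le_nhds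
    rw [sub_self, mul_zero, add_zero] at this
    exact (continuous_coe_real_ereal.tendsto K).comp this
  exact le_of_tendsto_of_tendsto (hrad α) hlimK hub
end

section
/- Let u be a harmonic function on the unit disc bounded above by M ∈ ℝ. Then for almost every α ∈ ℝ the radial limit lim_{r→1} u(re^{2πiα}) exists and is finite. -/
open Filter Set Metric MeasureTheory

lemma fatou_cauchy (R : ℂ → ℂ) (hc : Continuous R) (hd : DifferentiableOn ℂ R (ball 0 1))
    (z w : ℂ) (hz : z ∈ ball (0:ℂ) 1) (hw : 1 < ‖w‖) :
    (∮ ζ in C(0, 1), R ζ * (((ζ - z) ^ 2)⁻¹ - ((ζ - w) ^ 2)⁻¹)) = 2 * Real.pi * Complex.I * deriv R z := by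
  have hdz : DifferentiableAt ℂ R z := hd.differentiableAt (isOpen_ball.mem_nhds hz)
  have hzs : ∀ ζ ∈ sphere (0:ℂ) 1, ζ - z ≠ 0 := by
    intro ζ hζ h
    rw [sub_eq_zero] at h; subst h
    simp at hz hζ; linarith
  have hws : ∀ ζ ∈ closedBall (0:ℂ) 1, ζ - w ≠ 0 := by
    intro ζ hζ h
    rw [sub_eq_zero] at h; subst h
    simp at hζ; linarith
  have h1 : (∮ ζ in C(0, 1), (ζ - z)⁻¹ • dslope R z ζ) = (2 * Real.pi * Complex.I : ℂ) • dslope R z z := by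
    apply Complex.circleIntegral_sub_inv_smul_of_differentiable_on_off_countable (s := ∅) countable_empty hz
    · have : Continuous (dslope R z) := by
        rw [← continuousOn_univ]
        exact (continuousOn_dslope univ_mem).2 ⟨hc.continuousOn, hdz⟩
      exact this.continuousOn
    · intro x hx
      exact ((Complex.differentiableOn_dslope (isOpen_ball.mem_nhds hz)).2 hd).differentiableAt
        (isOpen_ball.mem_nhds hx.1)
  have h2 : (∮ ζ in C(0, 1), R ζ * ((ζ - w) ^ 2)⁻¹) = 0 := by
    apply Complex.circleIntegral_eq_zero_of_differentiable_on_off_countable (s := ∅) zero_le_one countable_empty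
    · apply hc.continuousOn.mul
      apply ContinuousOn.inv₀ (by fun_prop)
      intro x hx; exact pow_ne_zero 2 (hws x hx)
    · intro x hx
      have := hws x (ball_subset_closedBall hx.1)
      have h3 : DifferentiableAt ℂ R x := hd.differentiableAt (isOpen_ball.mem_nhds hx.1)
      exact h3.mul (DifferentiableAt.inv (by fun_prop) (pow_ne_zero 2 this))
  have h3 : (∮ ζ in C(0, 1), (ζ - z) ^ (-2 : ℤ)) = 0 :=
    circleIntegral.integral_sub_zpow_of_ne (by norm_num) _ _ _
  have ci : CircleIntegrable (fun ζ => R ζ * ((ζ - z) ^ 2)⁻¹) 0 1 := by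
    apply ContinuousOn.circleIntegrable zero_le_one
    apply hc.continuousOn.mul
    apply ContinuousOn.inv₀ (by fun_prop)
    intro x hx; exact pow_ne_zero 2 (hzs x hx)
  have ci2 : CircleIntegrable (fun ζ => R ζ * ((ζ - w) ^ 2)⁻¹) 0 1 := by
    apply ContinuousOn.circleIntegrable zero_le_one
    apply hc.continuousOn.mul
    apply ContinuousOn.inv₀ (by fun_prop)
    intro x hx; exact pow_ne_zero 2 (hws x (sphere_subset_closedBall hx))
  have ci3 : CircleIntegrable (fun ζ => R z * (ζ - z) ^ (-2:ℤ)) 0 1 := by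
    apply ContinuousOn.circleIntegrable zero_le_one
    apply continuousOn_const.mul
    apply ContinuousOn.zpow₀ (by fun_prop)
    intro x hx; exact Or.inl (hzs x hx)
  simp_rw [mul_sub]
  rw [circleIntegral.integral_sub ci ci2, h2, sub_zero]
  have h4 : (∮ ζ in C(0, 1), (ζ - z)⁻¹ • dslope R z ζ)
      = ∮ ζ in C(0, 1), (R ζ * ((ζ - z) ^ 2)⁻¹ - R z * (ζ - z) ^ (-2:ℤ)) := by
    apply circleIntegral.integral_congr zero_le_one
    intro ζ hζ
    have hne : ζ ≠ z := sub_ne_zero.1 (hzs ζ hζ)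
    simp only [dslope_of_ne _ hne, slope_def_field, smul_eq_mul]
    have := hzs ζ hζ
    rw [show (ζ - z) ^ (-2:ℤ) = ((ζ - z)^2)⁻¹ by rw [zpow_neg]; rfl]
    field_simp
  rw [circleIntegral.integral_sub ci ci3, circleIntegral.integral_const_mul, h3, mul_zero, sub_zero] at h4
  rw [← h4, h1, dslope_same, smul_eq_mul]

lemma fatou_reflect (a b : ℂ) (ha : ‖a‖ = 1) (hb : ‖b‖ = 1) (r : ℝ) (hr : 0 < r) :
    ‖a - b / r‖ = ‖a - r * b‖ / r := by
  have h1 : ‖a - b / r‖ = ‖r * a - b‖ / r := by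
    rw [show a - b / r = (r * a - b) / r by
      have : (r:ℂ) ≠ 0 := by exact_mod_cast hr.ne'
      field_simp]
    rw [norm_div, Complex.norm_real, Real.norm_of_nonneg hr.le]
  rw [h1]
  congr 1
  have h2 : ‖r * a - b‖ ^ 2 = ‖a - r * b‖ ^ 2 := by
    have ha' : a.re * a.re + a.im * a.im = 1 := by
      rw [← Complex.normSq_apply, Complex.normSq_eq_norm_sq, ha]; norm_num
    have hb' : b.re * b.re + b.im * b.im = 1 := by
      rw [← Complex.normSq_apply, Complex.normSq_eq_norm_sq, hb]; norm_num
    rw [← Complex.normSq_eq_norm_sq, ← Complex.normSq_eq_norm_sq, Complex.normSq_apply, Complex.normSq_apply]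
    simp
    linear_combination (r^2-1) * ha' + (1-r^2) * hb'
  exact (sq_eq_sq₀ (norm_nonneg _) (norm_nonneg _)).1 h2

lemma fatou_kernel (a b : ℂ) (ha : ‖a‖ = 1) (hb : ‖b‖ = 1) (r : ℝ) (hr : 1/2 ≤ r) (hr1 : r < 1) :
    ‖((a - r * b) ^ 2)⁻¹ - ((a - b / r) ^ 2)⁻¹‖ ≤ 8 * (1 - r) / ‖a - r * b‖ ^ 3 := by
  have hr0 : 0 < r := by linarith
  have hA : 0 < ‖a - r * b‖ := by
    have : ‖a‖ - ‖r * b‖ ≤ ‖a - r * b‖ := norm_sub_norm_le _ _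
    rw [norm_mul, ha, hb, Complex.norm_real, Real.norm_of_nonneg hr0.le] at this
    linarith
  have hB := fatou_reflect a b ha hb r hr0
  have hAB : ‖a - r * b‖ ≤ ‖a - b / r‖ := by
    rw [hB, le_div_iff₀ hr0]; nlinarith
  have hdiff : ‖(a - b / r) - (a - r * b)‖ ≤ 4 * (1 - r) := by
    have : (a - b / r) - (a - r * b) = ((r - 1 / r : ℝ) : ℂ) * b := by push_cast; ring
    rw [this, norm_mul, hb, Complex.norm_real, mul_one, Real.norm_eq_abs, abs_le]
    have h1 : (1 / r) * r = 1 := by field_simp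
    have h2 : 1 / r ≤ 2 := by rw [div_le_iff₀ hr0]; linarith
    constructor <;> nlinarith
  generalize a - r * b = A at *
  generalize a - b / r = B at *
  have hB0 : 0 < ‖B‖ := by linarith
  have hA' : A ≠ 0 := norm_pos_iff.1 hA
  have hB' : B ≠ 0 := norm_pos_iff.1 hB0
  rw [show (A ^ 2)⁻¹ - (B ^ 2)⁻¹ = (B - A) * (B + A) / (A ^ 2 * B ^ 2) by field_simp; ring]
  rw [norm_div, norm_mul, norm_mul, norm_pow, norm_pow]
  have h3 : ‖B + A‖ ≤ 2 * ‖B‖ := (norm_add_le _ _).trans (by linarith)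
  calc ‖B - A‖ * ‖B + A‖ / (‖A‖ ^ 2 * ‖B‖ ^ 2)
      ≤ (4 * (1 - r)) * (2 * ‖B‖) / (‖A‖ ^ 2 * ‖B‖ ^ 2) := by
        gcongr
    _ = 8 * (1 - r) / (‖A‖ ^ 2 * ‖B‖) := by field_simp; ring
    _ ≤ 8 * (1 - r) / (‖A‖ ^ 2 * ‖A‖) := by
        gcongr
    _ = _ := by ring

lemma fatou_poisson (z : ℂ) (hz : z ∈ ball (0:ℂ) 1) :
    ∫ θ in (0:ℝ)..2 * Real.pi, poissonKernel 0 z (circleMap 0 1 θ) = 2 * Real.pi := by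
  have h := InnerProductSpace.HarmonicContOnCl.circleAverage_poissonKernel_smul (f := fun _ => (1:ℝ)) (c := 0) (R := 1) (w := z)
    ⟨fun x _ => InnerProductSpace.harmonicAt_const _, continuousOn_const⟩ hz
  simp [Real.circleAverage] at h
  have hp := Real.pi_pos
  field_simp at h
  rw [mul_comm 2 Real.pi]
  exact h

lemma fatou_radial (G : ℂ → ℂ) (K : NNReal) (hG : LipschitzWith K G)
    (hd : DifferentiableOn ℂ G (ball 0 1)) (b c : ℂ) (hb : ‖b‖ = 1)
    (hlo : ∀ ε > 0, ∃ δ > 0, ∀ ζ : ℂ, ‖ζ‖ = 1 → ‖ζ - b‖ < δ →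
      ‖G ζ - G b - c * (ζ - b)‖ ≤ ε * ‖ζ - b‖) :
    Tendsto (fun r : ℝ => deriv G (r * b)) (nhdsWithin 1 (Iio 1)) (nhds c) := by
  -- main estimate
  have key : ∀ ε > 0, ∃ C : ℝ, 0 ≤ C ∧ ∀ r : ℝ, 1/2 ≤ r → r < 1 →
      ‖deriv G (r * b) - c‖ ≤ 16 * ε + 64 * C * (1 - r) := by
    intro ε hε
    obtain ⟨δ, hδ, hlo⟩ := hlo ε hε
    set R : ℂ → ℂ := fun ζ => G ζ - G b - c * (ζ - b) with hR
    set C : ℝ := (K + ‖c‖) / δ ^ 2 with hC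
    have hC0 : 0 ≤ C := by positivity
    have hRb : ∀ ζ : ℂ, ‖ζ‖ = 1 → ‖R ζ‖ ≤ ε * ‖ζ - b‖ + C * ‖ζ - b‖ ^ 3 := by
      intro ζ hζ
      by_cases h : ‖ζ - b‖ < δ
      · have := hlo ζ hζ h
        have h2 : 0 ≤ C * ‖ζ - b‖ ^ 3 := by positivity
        linarith
      · push Not at h
        have h1 : ‖R ζ‖ ≤ (K + ‖c‖) * ‖ζ - b‖ := by
          calc ‖R ζ‖ ≤ ‖G ζ - G b‖ + ‖c * (ζ - b)‖ := norm_sub_le _ _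
            _ ≤ K * ‖ζ - b‖ + ‖c‖ * ‖ζ - b‖ := by
              rw [norm_mul]
              gcongr
              exact hG.norm_sub_le ζ b
            _ = _ := by ring
        have h2 : (K + ‖c‖) * ‖ζ - b‖ ≤ C * ‖ζ - b‖ ^ 3 := by
          rw [hC, div_mul_eq_mul_div, le_div_iff₀ (by positivity)]
          have : (K + ‖c‖) * ‖ζ - b‖ * δ ^ 2 ≤ (K + ‖c‖) * ‖ζ - b‖ * ‖ζ - b‖ ^ 2 := by
            gcongr
          linarith
        have h3 : 0 ≤ ε * ‖ζ - b‖ := by positivity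
        linarith
    refine ⟨C, hC0, ?_⟩
    intro r hr hr1
    have hr0 : 0 < r := by linarith
    have hzn : ‖(r:ℂ) * b‖ = r := by
      rw [norm_mul, hb, Complex.norm_real, Real.norm_of_nonneg hr0.le, mul_one]
    have hz : (r:ℂ) * b ∈ ball (0:ℂ) 1 := by simpa [hb, abs_of_pos hr0] using hr1
    have hw : 1 < ‖b / (r:ℂ)‖ := by
      rw [norm_div, hb, Complex.norm_real, Real.norm_of_nonneg hr0.le, lt_div_iff₀ hr0]
      linarith
    have hRc : Continuous R := by
      have := hG.continuous
      fun_prop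
    have hRd : DifferentiableOn ℂ R (ball 0 1) := by
      fun_prop
    have hder : deriv R (r * b) = deriv G (r * b) - c := by
      have h1 : HasDerivAt G (deriv G (r*b)) (r*b) :=
        (hd.differentiableAt (isOpen_ball.mem_nhds hz)).hasDerivAt
      have h2 := (h1.sub_const (G b)).sub (((hasDerivAt_id ((r:ℂ) * b)).sub_const b).const_mul c)
      rw [mul_one] at h2
      exact h2.deriv
    have hcau := fatou_cauchy R hRc hRd _ _ hz hw
    rw [hder] at hcau
    have hpt : ∀ ζ : ℂ, ‖ζ‖ = 1 →
        ‖R ζ * (((ζ - r * b) ^ 2)⁻¹ - ((ζ - b / r) ^ 2)⁻¹)‖ ≤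
          16 * ε * poissonKernel 0 (r * b) ζ + 64 * C * (1 - r) := by
      intro ζ hζ
      have hk := fatou_kernel ζ b hζ hb r hr hr1
      have hR1 := hRb ζ hζ
      have hA1 : 1 - r ≤ ‖ζ - r * b‖ := by
        have : ‖ζ‖ - ‖r * b‖ ≤ ‖ζ - r * b‖ := norm_sub_norm_le _ _
        rw [hζ, hzn] at this
        exact this
      have hd2 : ‖ζ - b‖ ≤ 2 * ‖ζ - r * b‖ := by
        have h1 : ζ - b = (ζ - r * b) - ((1 - r : ℝ) : ℂ) * b := by push_cast; ring
        have h2 : ‖((1 - r : ℝ) : ℂ) * b‖ = 1 - r := by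
          rw [norm_mul, hb, Complex.norm_real, Real.norm_of_nonneg (by linarith), mul_one]
        rw [h1]
        refine (norm_sub_le _ _).trans ?_
        rw [h2]; linarith
      have hP : (1 - r) / ‖ζ - r * b‖ ^ 2 ≤ poissonKernel 0 (r * b) ζ := by
        simp only [poissonKernel, sub_zero, hζ, hzn]
        gcongr <;> nlinarith
      have hA0 : 0 < ‖ζ - r * b‖ := by linarith
      rw [norm_mul]
      generalize ‖ζ - r * b‖ = A at *
      calc _ ≤ (ε * ‖ζ - b‖ + C * ‖ζ - b‖ ^ 3) * (8 * (1 - r) / A ^ 3) := by gcongr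
        _ ≤ (ε * (2 * A) + C * (2 * A) ^ 3) * (8 * (1 - r) / A ^ 3) := by
          have : 0 ≤ 8 * (1 - r) / A ^ 3 := div_nonneg (by linarith) (by positivity)
          gcongr
        _ = 16 * ε * ((1 - r) / A ^ 2) + 64 * C * (1 - r) := by field_simp; ring
        _ ≤ _ := by gcongr
    have hPc : Continuous (fun θ : ℝ => poissonKernel 0 (r * b) (circleMap 0 1 θ)) := by
      simp only [poissonKernel, sub_zero]
      apply Continuous.div (by fun_prop) (by fun_prop)
      intro θ
      have : ‖circleMap 0 1 θ‖ = 1 := by simp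
      have h3 : ‖circleMap 0 1 θ‖ - ‖r * b‖ ≤ ‖circleMap 0 1 θ - r * b‖ := norm_sub_norm_le _ _
      rw [this, hzn] at h3
      have : 0 < ‖circleMap 0 1 θ - r * b‖ := by linarith
      positivity
    have hpi := Real.pi_pos
    have hint : ‖∮ ζ in C(0, 1), R ζ * (((ζ - r * b) ^ 2)⁻¹ - ((ζ - b / r) ^ 2)⁻¹)‖ ≤
        2 * Real.pi * (16 * ε + 64 * C * (1 - r)) := by
      unfold circleIntegral
      calc _ ≤ ∫ θ in (0:ℝ)..2 * Real.pi,
            (16 * ε * poissonKernel 0 (r * b) (circleMap 0 1 θ) + 64 * C * (1 - r)) := by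
            apply intervalIntegral.norm_integral_le_of_norm_le (by positivity)
            · refine Eventually.of_forall fun θ _ => ?_
              rw [norm_smul]
              have := hpt (circleMap 0 1 θ) (by simp)
              simpa using this
            · apply Continuous.intervalIntegrable
              fun_prop
        _ = _ := by
            rw [intervalIntegral.integral_add, intervalIntegral.integral_const_mul,
              fatou_poisson _ hz, intervalIntegral.integral_const]
            · simp; ring
            · exact (hPc.const_mul _).intervalIntegrable _ _
            · exact intervalIntegrable_const
    rw [hcau, norm_mul] at hint
    have h2pi : ‖(2 * Real.pi * Complex.I : ℂ)‖ = 2 * Real.pi := by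
      simp [abs_of_pos hpi]
    rw [h2pi] at hint
    exact le_of_mul_le_mul_left hint (by positivity)
  rw [Metric.tendsto_nhdsWithin_nhds]
  intro η hη
  obtain ⟨C, hC0, hC⟩ := key (η / 64) (by positivity)
  refine ⟨min (1/2) (η / (256 * (C + 1))), by positivity, ?_⟩
  intro r hr1 hr
  rw [mem_Iio] at hr1
  rw [Real.dist_eq, abs_sub_comm, abs_of_pos (by linarith), lt_min_iff] at hr
  obtain ⟨hr2, hr3⟩ := hr
  rw [lt_div_iff₀ (by positivity)] at hr3
  have := hC r (by linarith) hr1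
  rw [dist_eq_norm]
  have h1 : 64 * C * (1 - r) ≤ η / 4 := by nlinarith
  linarith

lemma fatou_little (G : ℂ → ℂ) (t : ℝ) (a : ℂ)
    (h : HasDerivAt (fun s : ℝ => G (circleMap 0 1 s)) a t) :
    ∀ ε > 0, ∃ δ > 0, ∀ ζ : ℂ, ‖ζ‖ = 1 → ‖ζ - circleMap 0 1 t‖ < δ →
      ‖G ζ - G (circleMap 0 1 t) - (a / (circleMap 0 1 t * Complex.I)) * (ζ - circleMap 0 1 t)‖
        ≤ ε * ‖ζ - circleMap 0 1 t‖ := by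
  intro ε hε
  set b := circleMap 0 1 t with hb
  have hbn : ‖b‖ = 1 := by simp [hb]
  have hb0 : b ≠ 0 := by rw [← norm_pos_iff, hbn]; norm_num
  set c := a / (b * Complex.I) with hc
  have hE : HasDerivAt (fun s : ℝ => G (circleMap 0 1 s) - G b - c * (circleMap 0 1 s - b)) 0 t := by
    have h1 := (h.sub_const (G b)).sub (((hasDerivAt_circleMap 0 1 t).sub_const b).const_mul c)
    have : a - c * (circleMap 0 1 t * Complex.I) = 0 := by
      rw [← hb, hc]
      have := Complex.I_ne_zero
      field_simp
      simp
    rwa [this] at h1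
  have hpi := Real.pi_pos
  have h2 := (hasDerivAt_iff_isLittleO.1 hE).def (c := ε / (Real.pi / 2)) (by positivity)
  rw [Metric.eventually_nhds_iff] at h2
  obtain ⟨δ, hδ, h2⟩ := h2
  refine ⟨δ / (Real.pi / 2), by positivity, ?_⟩
  intro ζ hζ hd
  have hζ0 : ζ ≠ 0 := by rw [← norm_pos_iff, hζ]; norm_num
  set s := Complex.arg (ζ / b) with hs
  have hle : |s| ≤ Real.pi / 2 * ‖ζ - b‖ := by
    rw [hs, ← Complex.angle_eq_abs_arg hζ0 hb0]
    exact Complex.angle_le_mul_norm_sub hζ hbn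
  have hcm : circleMap 0 1 (t + s) = ζ := by
    have h3 : Complex.exp (s * Complex.I) = ζ / b := by
      have := Complex.norm_mul_exp_arg_mul_I (ζ / b)
      rw [norm_div, hζ, hbn] at this
      simpa using this
    have h4 : circleMap 0 1 (t + s) = b * Complex.exp (s * Complex.I) := by
      simp [hb, circleMap, add_mul, Complex.exp_add]
    rw [h4, h3]; field_simp
  rw [lt_div_iff₀ (by positivity)] at hd
  have h5 := @h2 (t + s) (by
    rw [Real.dist_eq, add_sub_cancel_left]; linarith)
  rw [hcm, ← hb] at h5
  simp only [sub_self, mul_zero, sub_zero, smul_zero, add_sub_cancel_left, Real.norm_eq_abs] at h5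
  refine h5.trans ?_
  calc _ ≤ ε / (Real.pi / 2) * (Real.pi / 2 * ‖ζ - b‖) := by gcongr
    _ = _ := by field_simp

lemma fatou_bounded (h : ℂ → ℂ) (hd : DifferentiableOn ℂ h (ball 0 1))
    (hb : ∀ z ∈ ball (0:ℂ) 1, ‖h z‖ ≤ 1) :
    ∀ᵐ t : ℝ, ∃ c : ℂ, Tendsto (fun r : ℝ => h (r * circleMap 0 1 t))
      (nhdsWithin 1 (Iio 1)) (nhds c) := by
  obtain ⟨H, hH⟩ := hd.isExactOn_ball
  have hL : LipschitzOnWith 1 H (ball (0:ℂ) 1) := by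
    apply (convex_ball (0:ℂ) 1).lipschitzOnWith_of_nnnorm_hasDerivWithin_le (f' := h)
    · intro x hx; exact (hH x hx).hasDerivWithinAt
    · intro x hx; exact hb x hx
  obtain ⟨G, hG, hGH⟩ := hL.extend_finite_dimension
  have hder : ∀ z ∈ ball (0:ℂ) 1, HasDerivAt G (h z) z := by
    intro z hz
    apply (hH z hz).congr_of_eventuallyEq
    filter_upwards [isOpen_ball.mem_nhds hz] with w hw using (hGH hw).symm
  have hdG : DifferentiableOn ℂ G (ball 0 1) := fun z hz =>
    (hder z hz).differentiableAt.differentiableWithinAt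
  have hF := (hG.comp (lipschitzWith_circleMap 0 1)).ae_differentiableAt_real
  filter_upwards [hF] with t ht
  refine ⟨_, (fatou_radial G _ hG hdG (circleMap 0 1 t) _ (by simp)
    (fatou_little G t _ ht.hasDerivAt)).congr' ?_⟩
  have : Ioo (0:ℝ) 1 ∈ nhdsWithin (1:ℝ) (Iio 1) := Ioo_mem_nhdsLT zero_lt_one
  filter_upwards [this] with r hr
  apply (hder _ _).deriv
  simp [abs_of_pos hr.1, hr.2]


lemma fatou_liminf (f : ℂ → ℂ) (M : ℝ) (hf : DifferentiableOn ℂ f (ball 0 1))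
    (hM : ∀ z ∈ ball (0:ℂ) 1, (f z).re ≤ M) (r : ℕ → ℝ) (hr0 : ∀ n, 0 < r n) (hr1 : ∀ n, r n < 1) :
    ∀ᵐ t : ℝ, liminf (fun n => ENNReal.ofReal (M - (f (circleMap 0 (r n) t)).re)) atTop < ⊤ := by
  have hmem : ∀ n t, circleMap 0 (r n) t ∈ ball (0:ℂ) 1 := by
    intro n t
    simp [abs_of_pos (hr0 n), hr1 n]
  have hcf : ∀ n, Continuous (fun t : ℝ => f (circleMap 0 (r n) t)) := fun n =>
    hf.continuousOn.comp_continuous (continuous_circleMap 0 (r n)) (hmem n)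
  have hc : ∀ n, Continuous (fun t : ℝ => M - (f (circleMap 0 (r n) t)).re) := by
    intro n
    exact continuous_const.sub (Complex.continuous_re.comp (hcf n))
  have hpi := Real.pi_pos
  have hmean : ∀ n (a : ℝ), ∫ t in a..a + 2 * Real.pi, (M - (f (circleMap 0 (r n) t)).re)
      = 2 * Real.pi * (M - (f 0).re) := by
    intro n a
    have hper : Function.Periodic (fun t : ℝ => M - (f (circleMap 0 (r n) t)).re) (2 * Real.pi) := by
      intro t
      simp only [periodic_circleMap 0 (r n) t]
    rw [hper.intervalIntegral_add_eq a 0, zero_add]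
    have hdc : DiffContOnCl ℂ f (ball 0 |r n|) := by
      apply DifferentiableOn.diffContOnCl
      apply hf.mono
      rw [abs_of_pos (hr0 n)]
      exact closure_ball_subset_closedBall.trans (closedBall_subset_ball (hr1 n))
    have h1 := hdc.circleAverage
    rw [Real.circleAverage] at h1
    have h2 : ∫ t in (0:ℝ)..2 * Real.pi, f (circleMap 0 (r n) t) = (2 * Real.pi : ℝ) • f 0 := by
      rw [← h1, smul_smul, mul_inv_cancel₀ (by positivity), one_smul]
    have h3 : ∫ t in (0:ℝ)..2 * Real.pi, (f (circleMap 0 (r n) t)).re = 2 * Real.pi * (f 0).re := by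
      have := Complex.reCLM.intervalIntegral_comp_comm ((hcf n).intervalIntegrable (μ := volume) 0 (2 * Real.pi))
      simp only [Complex.reCLM_apply] at this
      rw [this, h2]
      simp
    have hcr : Continuous (fun t : ℝ => (f (circleMap 0 (r n) t)).re) :=
      Complex.continuous_re.comp (hcf n)
    rw [intervalIntegral.integral_sub intervalIntegrable_const (hcr.intervalIntegrable _ _), h3]
    simp; ring
  have hpiece : ∀ a : ℝ, ∀ᵐ t ∂(volume.restrict (Ioc a (a + 2 * Real.pi))),
      liminf (fun n => ENNReal.ofReal (M - (f (circleMap 0 (r n) t)).re)) atTop < ⊤ := by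
    intro a
    have hm : ∀ n, Measurable (fun t : ℝ => ENNReal.ofReal (M - (f (circleMap 0 (r n) t)).re)) :=
      fun n => (hc n).measurable.ennreal_ofReal
    apply ae_lt_top (Measurable.liminf hm)
    have hle := lintegral_liminf_le (μ := volume.restrict (Ioc a (a + 2 * Real.pi))) (u := atTop) hm
    apply ne_top_of_le_ne_top _ hle
    have heq : ∀ n, ∫⁻ t in Ioc a (a + 2 * Real.pi), ENNReal.ofReal (M - (f (circleMap 0 (r n) t)).re)
        = ENNReal.ofReal (2 * Real.pi * (M - (f 0).re)) := by
      intro n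
      rw [← hmean n a, intervalIntegral.integral_of_le (by linarith), ofReal_integral_eq_lintegral_ofReal]
      · exact ((hc n).intervalIntegrable a (a + 2 * Real.pi)).1
      · exact Eventually.of_forall fun t => sub_nonneg.2 (hM _ (hmem n t))
    simp only [heq, liminf_const]
    exact ENNReal.ofReal_ne_top
  have hU := iUnion_Ioc_add_zsmul (show 0 < 2 * Real.pi by positivity) 0
  rw [← Measure.restrict_univ (μ := volume), ← hU, ae_restrict_iUnion_iff]
  intro k
  have := hpiece (0 + k • (2 * Real.pi))
  rwa [add_assoc, show k • (2 * Real.pi) + 2 * Real.pi = (k + 1) • (2 * Real.pi) by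
    rw [add_smul, one_smul]] at this

theorem stmt18 (u : ℂ → ℝ) (M : ℝ)
    (hu : HarmonicOnUnitDisc u)
    (hM : ∀ z ∈ Metric.ball (0 : ℂ) 1, u z ≤ M) :
    ∀ᵐ α : ℝ, ∃ l : ℝ, Filter.Tendsto
      (fun r : ℝ => u ((r : ℂ) * Complex.exp (2 * Real.pi * Complex.I * (α : ℂ))))
      (nhdsWithin 1 (Set.Iio 1)) (nhds l) := by
  obtain ⟨f, hf, huf⟩ := hu
  have hM' : ∀ z ∈ ball (0:ℂ) 1, (f z).re ≤ M := fun z hz => huf z hz ▸ hM z hz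
  set h : ℂ → ℂ := fun z => Complex.exp (f z - M) with hh
  have hn : ∀ z, ‖h z‖ = Real.exp ((f z).re - M) := by
    intro z; simp [hh, Complex.norm_exp]
  have hb := fatou_bounded h (by fun_prop) (by
    intro z hz
    rw [hn, Real.exp_le_one_iff]
    linarith [hM' z hz])
  set r : ℕ → ℝ := fun n => 1 - 1 / ((n:ℝ) + 2) with hr
  have hr0 : ∀ n, 0 < r n := by
    intro n
    have : 1 / ((n:ℝ) + 2) < 1 := by rw [div_lt_one (by positivity)]; linarith [n.cast_nonneg (α := ℝ)]
    simp only [hr]; linarith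
  have hr1 : ∀ n, r n < 1 := by
    intro n
    have : 0 < 1 / ((n:ℝ) + 2) := by positivity
    simp only [hr]; linarith
  have hrt : Tendsto r atTop (nhdsWithin 1 (Iio 1)) := by
    apply tendsto_nhdsWithin_of_tendsto_nhds_of_eventually_within
    · have h1 : Tendsto (fun n : ℕ => 1 / ((n:ℝ) + 2)) atTop (nhds 0) := by
        have := (tendsto_natCast_atTop_atTop (R := ℝ)).atTop_add (tendsto_const_nhds (x := (2:ℝ)))
        refine this.inv_tendsto_atTop.congr fun n => ?_
        simp
      have h2 := (tendsto_const_nhds (x := (1:ℝ))).sub h1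
      rwa [sub_zero] at h2
    · exact Eventually.of_forall hr1
  have hl := fatou_liminf f M hf hM' r hr0 hr1
  have hθ : ∀ᵐ t : ℝ, ∃ l : ℝ, Tendsto (fun r : ℝ => u (r * circleMap 0 1 t))
      (nhdsWithin 1 (Iio 1)) (nhds l) := by
    filter_upwards [hb, hl] with t ⟨c, hc⟩ hlt
    have hnc := hc.norm
    have hc0 : c ≠ 0 := by
      rintro rfl
      apply hlt.ne
      apply Tendsto.liminf_eq
      rw [norm_zero] at hnc
      have h1 := hnc.comp hrt
      apply ENNReal.tendsto_ofReal_nhds_top.2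
      have h2 : Tendsto (fun n => (f (circleMap 0 (r n) t)).re - M) atTop atBot := by
        rw [← Real.tendsto_exp_comp_nhds_zero]
        refine h1.congr fun n => ?_
        simp [hn, circleMap]
      refine (tendsto_neg_atBot_atTop.comp h2).congr fun n => ?_
      simp
    have hlog := (hnc.log (norm_ne_zero_iff.2 hc0)).add_const M
    refine ⟨_, hlog.congr' ?_⟩
    have : Ioo (0:ℝ) 1 ∈ nhdsWithin (1:ℝ) (Iio 1) := Ioo_mem_nhdsLT zero_lt_one
    filter_upwards [this] with s hs
    rw [hn, Real.log_exp, huf _ (by simp [abs_of_pos hs.1, hs.2])]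
    ring
  have hq : Measure.QuasiMeasurePreserving (fun x : ℝ => (2 * Real.pi) * x) volume volume := by
    refine ⟨by fun_prop, ?_⟩
    rw [Real.map_volume_mul_left (by positivity)]
    exact Measure.smul_absolutelyContinuous
  filter_upwards [hq.ae hθ] with α hα
  convert hα using 7 with l s
  simp only [circleMap]
  push_cast
  simp
  congr 1; ring
end
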